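/- arXiv:2602.03565 — 2 statements merged into one kernel-verified Lean document; each statement's English description precedes it below -/
import Mathlib

section
/- Correctness of symbolic negation: for any symbolic vector sv, the underlying set of the negation ¬_sv(sv) = ({0}, ∅) \_sv sv equals the complement of uf(sv) in the set of all vectors: uf_svs(({0}, ∅) \_sv sv) = (uf(sv))ᶜ. -/
variable {n : ℕ}

/-- A vector is an element of ℕ^n. -/
abbrev Vec (n : ℕ) := Fin n → ℕ

/-- Componentwise (non-strict partial) order on vectors. -/
def vle (q q' : Vec n) : Prop := ∀ p, q p ≤ q' p

/-- Componentwise maximum (join) of two vectors. -/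
def vsup (q q' : Vec n) : Vec n := fun p => max (q p) (q' p)

/-- A symbolic vector is a pair of sets of vectors. -/
abbrev SymVec (n : ℕ) := Set (Vec n) × Set (Vec n)

/-- The underlying set of vectors of a symbolic vector. -/
def uf (sv : SymVec n) : Set (Vec n) :=
  {q | (∀ qa ∈ sv.1, vle qa q) ∧ ∀ qb ∈ sv.2, ¬ vle qb q}

/-- The underlying set of vectors of a set of symbolic vectors. -/
def ufSvs (S : Set (SymVec n)) : Set (Vec n) := ⋃ sv ∈ S, uf sv

/-- Difference of two symbolic vectors. -/
def svDiff (sv sv' : SymVec n) : Set (SymVec n) :=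
  {x | ∃ qc ∈ sv'.1, x = (sv.1, sv.2 ∪ {qc})} ∪
  {x | ∃ qd ∈ sv'.2, x = (sv.1 ∪ sv'.1 ∪ {qd}, sv.2)}

/-- Canonicity of a symbolic vector. -/
def Canonical (sv : SymVec n) : Prop :=
  ∃ qa, sv.1 = {qa} ∧
    ((∀ qb ∈ sv.2, ¬ vle qb qa) ∨ sv = ({0}, {0})) ∧
    (∀ qb ∈ sv.2, ∀ qb' ∈ sv.2, qb ≠ qb' → ¬ vle qb qb' ∧ ¬ vle qb' qb) ∧
    (∀ qb ∈ sv.2, ∀ p, qa p ≤ qb p)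

/-- Lexicographic (total) order on vectors. -/
def lexLe (q q' : Vec n) : Prop :=
  q = q' ∨ ∃ p, q p < q' p ∧ ∀ p', p' < p → q p' = q' p'

/-- Overlap relation (core form, on the components of canonical symbolic vectors). -/
def OverlapCore (qa : Vec n) (b : Set (Vec n)) (qc : Vec n) (d : Set (Vec n)) : Prop :=
  (∀ qb ∈ b, ¬ vle qb (vsup qa qc) ∨ (vle (vsup qa qc) qb ∧ vsup qa qc ≠ qb)) ∧
  (∀ qd ∈ d, ¬ vle qd (vsup qa qc) ∨ (vle (vsup qa qc) qd ∧ vsup qa qc ≠ qd))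

/-- Overlap relation on symbolic vectors. -/
def Overlap (sv sv' : SymVec n) : Prop :=
  ∃ qa qc, sv.1 = {qa} ∧ sv'.1 = {qc} ∧ OverlapCore qa sv.2 qc sv'.2

/-- Gap relation (core form). -/
def GapCore (qa : Vec n) (b : Set (Vec n)) (qc : Vec n) (d : Set (Vec n)) : Prop :=
  (∃ qb ∈ b, vle qb (vsup qa qc) ∧ qb ≠ vsup qa qc) ∨
  (∃ qd ∈ d, vle qd (vsup qa qc) ∧ qd ≠ vsup qa qc) ∨
  (vsup qa qc ∈ b ∧ vsup qa qc ∈ d)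

/-- Gap relation on symbolic vectors. -/
def Gap (sv sv' : SymVec n) : Prop :=
  ∃ qa qc, sv.1 = {qa} ∧ sv'.1 = {qc} ∧ GapCore qa sv.2 qc sv'.2

/-- Mergeable relation (core form, nonempty case). -/
def MergeableCore (qa : Vec n) (b : Set (Vec n)) (qc : Vec n) (d : Set (Vec n)) : Prop :=
  (vle qa qc ∧ ∀ qb ∈ b, vle qc qb ∨ ∃ qd ∈ d, vle qd (vsup qb qc)) ∨
  (vle qc qa ∧ ∀ qd ∈ d, vle qa qd ∨ ∃ qb ∈ b, vle qb (vsup qd qa))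

/-- Mergeable relation on symbolic vectors. -/
def Mergeable (sv sv' : SymVec n) : Prop :=
  uf sv = ∅ ∨ uf sv' = ∅ ∨
  ∃ qa qc, sv.1 = {qa} ∧ sv'.1 = {qc} ∧ MergeableCore qa sv.2 qc sv'.2

/-- Shareable relation (core form, nonempty case). -/
def ShareableCore (qa : Vec n) (b : Set (Vec n)) (qc : Vec n) (d : Set (Vec n)) : Prop :=
  (lexLe qa qc ∧ (∀ qb ∈ b, ¬ (vle qb (vsup qa qc) ∧ qb ≠ vsup qa qc)) ∧
    (∀ qd ∈ d, ¬ vle qd (vsup qa qc))) ∨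
  (lexLe qc qa ∧ qc ≠ qa ∧ (∀ qd ∈ d, ¬ (vle qd (vsup qa qc) ∧ qd ≠ vsup qa qc)) ∧
    (∀ qb ∈ b, ¬ vle qb (vsup qa qc)))

/-- Shareable relation on symbolic vectors. -/
def Shareable (sv sv' : SymVec n) : Prop :=
  uf sv = ∅ ∨ uf sv' = ∅ ∨
  ∃ qa qc, sv.1 = {qa} ∧ sv'.1 = {qc} ∧ ShareableCore qa sv.2 qc sv'.2

/-- Canonicity of a (finite) symbolic vector set. -/
def CanonicalSVS (svs : Set (SymVec n)) : Prop :=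
  (∀ sv ∈ svs, Canonical sv) ∧
  ((∃ sv ∈ svs, uf sv ≠ ∅) ∨ svs = ∅) ∧
  (∀ sv ∈ svs, ∀ sv' ∈ svs, sv ≠ sv' → ¬ Shareable sv sv')

/-- The difference of symbolic vectors denotes the set difference of their underlying sets. -/
theorem ufSvs_svDiff (sv sv' : SymVec n) : ufSvs (svDiff sv sv') = uf sv \ uf sv' := by
  ext q
  simp only [ufSvs, svDiff, Set.mem_iUnion, exists_prop, Set.mem_sdiff]
  constructor
  · rintro ⟨_, ⟨qc, hqc, rfl⟩ | ⟨qd, hqd, rfl⟩, hlo, hup⟩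
    · exact ⟨⟨hlo, fun qb hqb => hup qb (.inl hqb)⟩, fun h => hup qc (.inr rfl) (h.1 qc hqc)⟩
    · exact ⟨⟨fun qa hqa => hlo qa (.inl (.inl hqa)), hup⟩,
        fun h => h.2 qd hqd (hlo qd (.inr rfl))⟩
  · rintro ⟨⟨hlo, hup⟩, hq⟩
    by_cases hc : ∀ qc ∈ sv'.1, vle qc q
    · obtain ⟨qd, hqd, hle⟩ : ∃ qd ∈ sv'.2, vle qd q := by
        by_contra! h
        exact hq ⟨hc, h⟩
      refine ⟨_, .inr ⟨qd, hqd, rfl⟩, ?_, hup⟩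
      rintro qa ((hqa | hqa) | rfl)
      exacts [hlo qa hqa, hc qa hqa, hle]
    · push Not at hc
      obtain ⟨qc, hqc, hle⟩ := hc
      refine ⟨_, .inl ⟨qc, hqc, rfl⟩, hlo, ?_⟩
      rintro qb (hqb | rfl)
      exacts [hup qb hqb, hle]

/-- Every vector belongs to the symbolic vector `({0}, ∅)`. -/
theorem uf_zero_empty : uf (({0}, ∅) : SymVec n) = Set.univ := by
  simp [uf, vle]

/-- Correctness of symbolic negation: the underlying set of the negation of a
symbolic vector is the complement of its underlying set. -/
theorem uf_neg (sv : SymVec n) :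
    ufSvs (svDiff (({0}, ∅) : SymVec n) sv) = (uf sv)ᶜ := by
  rw [ufSvs_svDiff, uf_zero_empty, Set.compl_eq_univ_sdiff]
end

section
/- For canonical symbolic vectors sv and sv': if shareable(sv, sv') does not hold, then the underlying sets are disjoint: uf(sv) ∩ uf(sv') = ∅. -/
variable {n : ℕ}

theorem lexLe_total (q q' : Vec n) : lexLe q q' ∨ lexLe q' q := by
  rcases le_total (toLex q) (toLex q') with h | h <;> rcases h.eq_or_lt with h | ⟨p, hp, hlt⟩
  · exact Or.inl (Or.inl (toLex.injective h))
  · exact Or.inl (Or.inr ⟨p, hlt, hp⟩)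
  · exact Or.inr (Or.inl (toLex.injective h))
  · exact Or.inr (Or.inr ⟨p, hlt, hp⟩)

theorem vle_trans {q r s : Vec n} (h : vle q r) (h' : vle r s) : vle q s :=
  fun p => (h p).trans (h' p)

theorem vsup_vle {q r s : Vec n} (h : vle q s) (h' : vle r s) : vle (vsup q r) s :=
  fun p => max_le (h p) (h' p)

/-- Non-shareable canonical symbolic vectors have disjoint underlying sets. -/
theorem not_shareable_disjoint (sv sv' : SymVec n)
    (h : Canonical sv) (h' : Canonical sv') (hs : ¬ Shareable sv sv') :
    uf sv ∩ uf sv' = ∅ := by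
  obtain ⟨qa, ha, -⟩ := h
  obtain ⟨qc, hc, -⟩ := h'
  refine Set.eq_empty_iff_forall_notMem.2 ?_
  rintro q ⟨⟨haq, hbq⟩, hcq, hdq⟩
  have hq : vle (vsup qa qc) q := vsup_vle (haq qa (by simp [ha])) (hcq qc (by simp [hc]))
  have hb : ∀ qb ∈ sv.2, ¬ vle qb (vsup qa qc) := fun qb m l => hbq qb m (vle_trans l hq)
  have hd : ∀ qd ∈ sv'.2, ¬ vle qd (vsup qa qc) := fun qd m l => hdq qd m (vle_trans l hq)
  refine hs (Or.inr (Or.inr ⟨qa, qc, ha, hc, ?_⟩))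
  by_cases hac : lexLe qa qc
  · exact Or.inl ⟨hac, fun qb m l => hb qb m l.1, hd⟩
  · refine Or.inr ⟨(lexLe_total qa qc).resolve_left hac, ?_, fun qd m l => hd qd m l.1, hb⟩
    exact fun e => hac (Or.inl e.symm)
end
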